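/- Let M = ⟨S, A, P, R, H, ρ₀⟩ be a finite-horizon episodic MDP with expert policy π_e, and draw n ≥ 2 trajectories τ^{(1)},…,τ^{(n)} i.i.d. from the trajectory distribution p of π_e (each of full length H). For each trajectory define the empirical occupancy ϱ^{(i)}(s) = |{t ∈ {0,…,H−1} : τ_t^{(i)} = s}| / H, set ρ̂(s) = (1/n) Σ_{i=1}^n ϱ^{(i)}(s), and let V_n(s) = (1/(n−1)) Σ_{i=1}^n (ϱ^{(i)}(s) − ρ̂(s))² denote the sample variance of ϱ^{(1)}(s),…,ϱ^{(n)}(s). Fix δ ∈ (0,1) and ξ ≥ 0, let Ŝ ⊆ S be any subset satisfying Σ_{s∈S∖Ŝ} ρ̂(s) ≤ ξ, let M̂ be the corresponding e-stop MDP, and let π̂* be a policy maximizing J_{M̂} over all policies. Then, with probability at least 1 − δ over the draw of the n trajectories, J_M(π_e) − J_M(π̂*) ≤ (ξ + √(2 log(2|S|/δ)/n) · Σ_{s∈S} √(V_n(s)) + 7|S| log(2|S|/δ) / (3(n−1))) · H². -/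

import Mathlib

open Finset

/-- A finite-horizon episodic MDP `⟨S, A, P, R, H, ρ₀⟩`. -/
structure MDP (S A : Type*) [Fintype S] [Fintype A] where
  P : S → A → S → ℝ
  P_nonneg : ∀ s a s', 0 ≤ P s a s'
  P_sum : ∀ s a, ∑ s' : S, P s a s' = 1
  R : S → A → S → ℝ
  R_nonneg : ∀ s a s', 0 ≤ R s a s'
  R_le_one : ∀ s a s', R s a s' ≤ 1
  H : ℕ
  H_pos : 0 < H
  ρ0 : S → ℝ
  ρ0_nonneg : ∀ s, 0 ≤ ρ0 s
  ρ0_sum : ∑ s : S, ρ0 s = 1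

/-- A (time-dependent, stochastic) policy. -/
structure Policy (S A : Type*) [Fintype A] where
  p : ℕ → S → A → ℝ
  nonneg : ∀ t s a, 0 ≤ p t s a
  sum_one : ∀ t s, ∑ a : A, p t s a = 1

/-- The time-`t` state distribution `ρ_π^t`. -/
noncomputable def stateDist {S A : Type*} [Fintype S] [Fintype A]
    (P : S → A → S → ℝ) (pol : ℕ → S → A → ℝ) (ρ0 : S → ℝ) : ℕ → S → ℝ
  | 0 => ρ0
  | t + 1 => fun s => ∑ s' : S, ∑ a : A, stateDist P pol ρ0 t s' * pol t s' a * P s' a s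

/-- Expected cumulative reward `J = ∑_{t=0}^{H-2} ∑_{s,a,s'} ρ^t(s) π(a|s,t) P(s,a,s') R(s,a,s')`. -/
noncomputable def valueJ {S A : Type*} [Fintype S] [Fintype A]
    (P : S → A → S → ℝ) (R : S → A → S → ℝ) (H : ℕ) (ρ0 : S → ℝ)
    (pol : ℕ → S → A → ℝ) : ℝ :=
  ∑ t ∈ Finset.range (H - 1), ∑ s : S, ∑ a : A, ∑ s' : S,
    stateDist P pol ρ0 t s * pol t s a * P s a s' * R s a s'

/-- `J_M(π)`. -/
noncomputable def MDP.J {S A : Type*} [Fintype S] [Fintype A]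
    (M : MDP S A) (π : Policy S A) : ℝ :=
  valueJ M.P M.R M.H M.ρ0 π.p

/-- State space `Ŝ ∪ {s_term}` of the e-stop MDP; `none` is the absorbing state `s_term`. -/
abbrev EState (S : Type*) (Shat : Finset S) := Option {s : S // s ∈ Shat}

/-- Transition kernel of the e-stop MDP. -/
noncomputable def estopP {S A : Type*} [Fintype S] [DecidableEq S]
    (P : S → A → S → ℝ) (Shat : Finset S) :
    EState S Shat → A → EState S Shat → ℝ
  | some s, a, some s' => P s.1 a s'.1
  | some s, a, none => ∑ s' ∈ Shatᶜ, P s.1 a s'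
  | none, _, some _ => 0
  | none, _, none => 1

/-- Reward of the e-stop MDP: zero on any transition into or out of `s_term`. -/
noncomputable def estopR {S A : Type*} (R : S → A → S → ℝ) (Shat : Finset S) :
    EState S Shat → A → EState S Shat → ℝ
  | some s, a, some s' => R s.1 a s'.1
  | _, _, _ => 0

/-- Initial distribution of the e-stop MDP. -/
noncomputable def estopρ0 {S : Type*} [Fintype S] [DecidableEq S]
    (ρ0 : S → ℝ) (Shat : Finset S) : EState S Shat → ℝ
  | some s => ρ0 s.1
  | none => ∑ s ∈ Shatᶜ, ρ0 s

/-- The policy induced on the e-stop MDP by restriction (acting uniformly at `s_term`). -/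
noncomputable def estopPol {S A : Type*} [Fintype A]
    (pol : ℕ → S → A → ℝ) (Shat : Finset S) :
    ℕ → EState S Shat → A → ℝ :=
  fun t s a => match s with
    | some s => pol t s.1 a
    | none => (Fintype.card A : ℝ)⁻¹

/-- `J_{M̂}(π)`: expected cumulative reward of (the restriction of) `π` in the e-stop MDP. -/
noncomputable def estopJ {S A : Type*} [Fintype S] [DecidableEq S] [Fintype A]
    (M : MDP S A) (Shat : Finset S) (π : Policy S A) : ℝ :=
  valueJ (estopP M.P Shat) (estopR M.R Shat) M.H (estopρ0 M.ρ0 Shat) (estopPol π.p Shat)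

/-- Probability of the trajectory `τ = (τ₀, …, τ_{H-1})` under policy `π` in `M`. -/
noncomputable def trajProb {S A : Type*} [Fintype S] [Fintype A]
    (M : MDP S A) (π : Policy S A) (τ : Fin M.H → S) : ℝ :=
  M.ρ0 (τ ⟨0, M.H_pos⟩) *
    ∏ t : Fin (M.H - 1), ∑ a : A,
      π.p t.1 (τ ⟨t.1, Nat.lt_of_lt_of_le t.2 (Nat.sub_le _ _)⟩) a *
        M.P (τ ⟨t.1, Nat.lt_of_lt_of_le t.2 (Nat.sub_le _ _)⟩) a
          (τ ⟨t.1 + 1, by have := t.2; omega⟩)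

/-- Hitting probability `h(s)`: the probability that `π` visits `s` during an episode. -/
noncomputable def hitProb {S A : Type*} [Fintype S] [DecidableEq S] [Fintype A]
    (M : MDP S A) (π : Policy S A) (s : S) : ℝ :=
  ∑ τ : Fin M.H → S, trajProb M π τ * (if ∃ t, τ t = s then 1 else 0)

/-- Average state distribution `ρ_π(s) = (1/H) ∑_{t=0}^{H-1} ρ_π^t(s)`. -/
noncomputable def avgDist {S A : Type*} [Fintype S] [Fintype A]
    (M : MDP S A) (π : Policy S A) (s : S) : ℝ :=
  (M.H : ℝ)⁻¹ * ∑ t ∈ Finset.range M.H, stateDist M.P π.p M.ρ0 t s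
/-- Empirical occupancy `ϱ(s)` of a state in a single length-`H` trajectory. -/
noncomputable def occ {S : Type*} [DecidableEq S] {H : ℕ} (τ : Fin H → S) (s : S) : ℝ :=
  ((Finset.univ.filter fun t => τ t = s).card : ℝ) / H

/-- Empirical average state distribution `ρ̂(s)` from `n` sampled trajectories. -/
noncomputable def empAvg {S : Type*} [DecidableEq S] {H n : ℕ}
    (ω : Fin n → Fin H → S) (s : S) : ℝ :=
  (1 / n : ℝ) * ∑ i : Fin n, occ (ω i) s

/-- Sample variance `V_n` of the occupancies `ϱ^{(1)}(s), …, ϱ^{(n)}(s)`. -/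
noncomputable def sampleVar {S : Type*} [DecidableEq S] {H n : ℕ}
    (ω : Fin n → Fin H → S) (s : S) : ℝ :=
  ((n : ℝ) - 1)⁻¹ * ∑ i : Fin n, (occ (ω i) s - empAvg ω s) ^ 2

section IidConcentration

open Real

/-- Expectation of `f` under the `ι`-fold product of the weights `p`. -/
noncomputable def iidExp {T ι : Type*} [Fintype T] [Fintype ι] [DecidableEq ι] (p : T → ℝ)
    (f : (ι → T) → ℝ) : ℝ :=
  ∑ ω : ι → T, (∏ i, p (ω i)) * f ω

variable {T ι : Type*} [Fintype T] [Fintype ι] [DecidableEq ι]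

theorem iidExp_mono {p : T → ℝ} (hp : ∀ τ, 0 ≤ p τ) {f g : (ι → T) → ℝ} (h : ∀ ω, f ω ≤ g ω) :
    iidExp p f ≤ iidExp p g :=
  sum_le_sum fun ω _ => mul_le_mul_of_nonneg_left (h ω) (prod_nonneg fun i _ => hp (ω i))

theorem iidExp_const_mul (p : T → ℝ) (c : ℝ) (f : (ι → T) → ℝ) :
    iidExp p (fun ω => c * f ω) = c * iidExp p f := by
  simp only [iidExp, mul_sum]
  exact sum_congr rfl fun _ _ => by ring

theorem iidExp_add (p : T → ℝ) (f g : (ι → T) → ℝ) :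
    iidExp p (fun ω => f ω + g ω) = iidExp p f + iidExp p g := by
  simp only [iidExp, mul_add, sum_add_distrib]

theorem iidExp_sum {κ : Type*} (s : Finset κ) (p : T → ℝ) (f : κ → (ι → T) → ℝ) :
    iidExp p (fun ω => ∑ k ∈ s, f k ω) = ∑ k ∈ s, iidExp p (f k) := by
  simp only [iidExp, mul_sum]
  exact sum_comm

theorem iidExp_prod (p g : T → ℝ) :
    iidExp p (fun ω : ι → T => ∏ i, g (ω i)) = (∑ τ, p τ * g τ) ^ Fintype.card ι := by
  simp only [iidExp, ← prod_mul_distrib]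
  rw [← Fintype.prod_sum (fun (_ : ι) τ => p τ * g τ)]
  simp

theorem iidExp_one {p : T → ℝ} (hp1 : ∑ τ, p τ = 1) :
    iidExp p (fun _ : ι → T => 1) = 1 := by
  simpa [hp1] using iidExp_prod (ι := ι) p (fun _ => 1)

theorem iidExp_reindex {κ : Type*} [Fintype κ] [DecidableEq κ] (e : κ ≃ ι) (p : T → ℝ)
    (f : (κ → T) → ℝ) :
    iidExp p (fun ω : ι → T => f (fun k => ω (e k))) = iidExp p f := by
  unfold iidExp
  refine Fintype.sum_equiv (Equiv.arrowCongr e.symm (Equiv.refl T)) _ _ fun ω => ?_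
  congr 1
  exact (Equiv.prod_comp e (fun i => p (ω i))).symm

theorem iidExp_sumType {κ κ' : Type*} [Fintype κ] [DecidableEq κ] [Fintype κ'] [DecidableEq κ']
    {p : T → ℝ} (hp1 : ∑ τ, p τ = 1) (f : (κ → T) → ℝ) :
    iidExp p (fun ω : κ ⊕ κ' → T => f (fun k => ω (Sum.inl k))) = iidExp p f := by
  have h1 := iidExp_one (ι := κ') hp1
  simp only [iidExp, mul_one] at h1 ⊢
  rw [Fintype.sum_equiv (Equiv.sumArrowEquivProdArrow κ κ' T) _
    (fun ω => ((∏ i, p (ω.1 i)) * f ω.1) * ∏ i, p (ω.2 i))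
    (fun ω => by
      simp only [Fintype.prod_sum_type, Equiv.sumArrowEquivProdArrow, Equiv.coe_fn_mk,
        Function.comp_def]
      ring),
    Fintype.sum_prod_type]
  simp only [← mul_sum, h1, mul_one]

theorem iidExp_prod_pairs (m : ℕ) (p : T → ℝ) (g : T → T → ℝ) :
    iidExp p (fun ω : Fin m × Bool → T => ∏ j, g (ω (j, false)) (ω (j, true))) =
      (∑ τ, ∑ τ', p τ * p τ' * g τ τ') ^ m := by
  have h := iidExp_prod (ι := Fin m) (fun x : T × T => p x.1 * p x.2) (fun x => g x.1 x.2)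
  rw [Fintype.card_fin, Fintype.sum_prod_type] at h
  rw [← h]
  unfold iidExp
  refine Fintype.sum_equiv ((Equiv.curry (Fin m) Bool T).trans
    (Equiv.arrowCongr (Equiv.refl _) (Equiv.boolArrowEquivProd T))) _ _ fun ω => ?_
  simp [Fintype.prod_prod_type, Equiv.boolArrowEquivProd, mul_comm]

/-- Chernoff's bound. -/
theorem iidExp_indicator_le {p : T → ℝ} (hp : ∀ τ, 0 ≤ p τ) (E : (ι → T) → Prop)
    [DecidablePred E] (F : (ι → T) → ℝ) (h : ∀ ω, E ω → 0 ≤ F ω) :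
    iidExp p (fun ω => if E ω then 1 else 0) ≤ iidExp p (fun ω => exp (F ω)) := by
  refine iidExp_mono hp fun ω => ?_
  split_ifs with hE
  · exact one_le_exp (h ω hE)
  · exact (exp_pos _).le

theorem hasSum_exp_sub_one_sub (x : ℝ) :
    HasSum (fun k : ℕ => x ^ (k + 2) / (k + 2).factorial) (exp x - 1 - x) := by
  have h := NormedSpace.expSeries_div_hasSum_exp x
  rw [← Real.exp_eq_exp_ℝ] at h
  have := (hasSum_nat_add_iff' 2).2 h
  simpa [sum_range_succ, sub_sub] using this

theorem exp_mul_le_bennett {l y : ℝ} (hl : 0 ≤ l) (hy : |y| ≤ 1) :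
    exp (l * y) ≤ 1 + l * y + y ^ 2 * (exp l - 1 - l) := by
  have h := hasSum_le (fun k : ℕ => ?_) (hasSum_exp_sub_one_sub (l * y))
    ((hasSum_exp_sub_one_sub l).mul_left (y ^ 2))
  · linarith
  · rw [← mul_div_assoc]
    gcongr
    have h1 : y ^ k ≤ 1 := (le_abs_self _).trans (by rw [abs_pow]; exact pow_le_one₀ (abs_nonneg _) hy)
    calc (l * y) ^ (k + 2) = y ^ 2 * l ^ (k + 2) * y ^ k := by ring
      _ ≤ y ^ 2 * l ^ (k + 2) * 1 := by gcongr
      _ = _ := mul_one _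

theorem exp_sub_one_sub_le {l : ℝ} (hl : 0 ≤ l) (hl3 : l < 3) :
    exp l - 1 - l ≤ l ^ 2 / (2 * (1 - l / 3)) := by
  have h := hasSum_le (fun k : ℕ => ?_) (hasSum_exp_sub_one_sub l)
    ((hasSum_geometric_of_lt_one (r := l / 3) (by positivity) (by linarith)).mul_left (l ^ 2 / 2))
  · refine h.trans_eq ?_
    rw [div_mul_eq_div_div, div_eq_mul_inv (l ^ 2 / 2)]
  · have hk : ((2 * 3 ^ k : ℕ) : ℝ) ≤ ((k + 2).factorial : ℝ) := by
      have := Nat.factorial_mul_pow_le_factorial (m := 2) (n := k)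
      rw [add_comm 2 k] at this
      exact_mod_cast this
    push_cast at hk
    calc l ^ (k + 2) / ((k + 2).factorial : ℝ) ≤ l ^ (k + 2) / (2 * 3 ^ k) := by gcongr
      _ = _ := by rw [div_pow]; field_simp; ring

/-- Bennett's bound on the moment generating function of an i.i.d. sum. -/
theorem iidExp_exp_sum_le {p Y : T → ℝ} (hp : ∀ τ, 0 ≤ p τ) (hp1 : ∑ τ, p τ = 1)
    (hY : ∀ τ, |Y τ| ≤ 1) (hY0 : ∑ τ, p τ * Y τ = 0) {l : ℝ} (hl : 0 ≤ l) :
    iidExp p (fun ω : ι → T => exp (l * ∑ i, Y (ω i))) ≤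
      exp (Fintype.card ι * ((∑ τ, p τ * Y τ ^ 2) * (exp l - 1 - l))) := by
  simp only [mul_sum univ _ l, exp_sum]
  rw [iidExp_prod p (fun τ => exp (l * Y τ)), exp_nat_mul]
  refine pow_le_pow_left₀ (sum_nonneg fun τ _ => mul_nonneg (hp τ) (exp_pos _).le) ?_ _
  calc ∑ τ, p τ * exp (l * Y τ)
      ≤ ∑ τ, p τ * (1 + l * Y τ + Y τ ^ 2 * (exp l - 1 - l)) :=
        sum_le_sum fun τ _ => mul_le_mul_of_nonneg_left (exp_mul_le_bennett hl (hY τ)) (hp τ)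
    _ = ∑ τ, (p τ + l * (p τ * Y τ) + p τ * Y τ ^ 2 * (exp l - 1 - l)) :=
        sum_congr rfl fun _ _ => by ring
    _ = (∑ τ, p τ * Y τ ^ 2) * (exp l - 1 - l) + 1 := by
        rw [sum_add_distrib, sum_add_distrib, ← mul_sum, ← sum_mul, hp1, hY0]; ring
    _ ≤ _ := add_one_le_exp _

/-- Bernstein's inequality, with the deviation expressed through the confidence level. -/
theorem bernstein_tail {p Y : T → ℝ} (hp : ∀ τ, 0 ≤ p τ) (hp1 : ∑ τ, p τ = 1)
    (hY : ∀ τ, |Y τ| ≤ 1) (hY0 : ∑ τ, p τ * Y τ = 0) {L : ℝ} (hL : 0 ≤ L)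
    (E : (ι → T) → Prop) [DecidablePred E]
    (hE : ∀ ω, E ω → √(2 * (Fintype.card ι * ∑ τ, p τ * Y τ ^ 2) * L) + L / 3 ≤
      ∑ i, Y (ω i)) :
    iidExp p (fun ω : ι → T => if E ω then 1 else 0) ≤ exp (-L) := by
  set v : ℝ := Fintype.card ι * ∑ τ, p τ * Y τ ^ 2 with hv
  have hv0 : 0 ≤ v := mul_nonneg (Nat.cast_nonneg _)
    (sum_nonneg fun τ _ => mul_nonneg (hp τ) (sq_nonneg _))
  have chernoff : ∀ l, 0 ≤ l →
      iidExp p (fun ω : ι → T => if E ω then 1 else 0) ≤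
        exp (v * (exp l - 1 - l) - l * (√(2 * v * L) + L / 3)) := by
    intro l hl
    refine (iidExp_indicator_le hp E
      (fun ω => -(l * (√(2 * v * L) + L / 3)) + l * ∑ i, Y (ω i)) fun ω h => ?_).trans ?_
    · have := mul_le_mul_of_nonneg_left (hE ω h) hl
      linarith
    · simp only [exp_add]
      rw [iidExp_const_mul, sub_eq_neg_add, exp_add, hv, mul_assoc (Fintype.card ι : ℝ)]
      exact mul_le_mul_of_nonneg_left (iidExp_exp_sum_le hp hp1 hY hY0 hl) (exp_pos _).le
  rcases hv0.eq_or_lt with h0 | hvpos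
  · refine (chernoff 3 (by norm_num)).trans (exp_le_exp.2 ?_)
    rw [← h0, mul_zero, zero_mul, zero_mul, sqrt_zero]
    linarith
  · set u := √(2 * L / v) with hu
    have hu0 : 0 ≤ u := sqrt_nonneg _
    have hu2 : u ^ 2 * v = 2 * L := by
      rw [hu, sq_sqrt (by positivity)]
      field_simp
    have hsq : √(2 * v * L) = v * u := by
      rw [sqrt_eq_iff_mul_self_eq (by positivity) (by positivity)]
      linear_combination -v * hu2
    have hd : 0 < 1 + u / 3 := by positivity
    refine (chernoff (u / (1 + u / 3)) (by positivity)).trans (exp_le_exp.2 ?_)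
    have hl3 : u / (1 + u / 3) < 3 := by
      rw [div_lt_iff₀ hd]; linarith
    have h1 := mul_le_mul_of_nonneg_left (exp_sub_one_sub_le (by positivity) hl3) hv0
    have h2 : v * ((u / (1 + u / 3)) ^ 2 / (2 * (1 - u / (1 + u / 3) / 3))) -
        u / (1 + u / 3) * (v * u + L / 3) = -L := by
      have h3 : 1 - u / (1 + u / 3) / 3 = 1 / (1 + u / 3) := by field_simp; ring
      rw [h3]
      field_simp
      linear_combination -3 * hu2
    rw [hsq]
    linarith

theorem exists_perm_apply_eq_apply_eq {α : Type*} [DecidableEq α] {a b c d : α} (hab : a ≠ b)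
    (hcd : c ≠ d) : ∃ g : Equiv.Perm α, g a = c ∧ g b = d := by
  refine ⟨Equiv.swap (Equiv.swap a c b) d * Equiv.swap a c, ?_, ?_⟩
  · rw [Equiv.Perm.mul_apply, Equiv.swap_apply_left]
    refine Equiv.swap_apply_of_ne_of_ne (fun h => hab ?_) hcd
    apply (Equiv.swap a c).injective
    rw [Equiv.swap_apply_left, ← h]
  · rw [Equiv.Perm.mul_apply, Equiv.swap_apply_left]

theorem sum_perm_apply_pair (F : ι → ι → ℝ) (hF : ∀ i, F i i = 0) {a b : ι} (hab : a ≠ b) :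
    (Fintype.card ι : ℝ) * (Fintype.card ι - 1) * ∑ g : Equiv.Perm ι, F (g a) (g b) =
      (Fintype.card ι).factorial * ∑ i, ∑ j, F i j := by
  have hT : ∀ c d, ∑ g : Equiv.Perm ι, F (g c) (g d) =
      if c = d then 0 else ∑ g : Equiv.Perm ι, F (g a) (g b) := by
    intro c d
    split_ifs with hcd
    · simp [hcd, hF]
    · obtain ⟨k, hk1, hk2⟩ := exists_perm_apply_eq_apply_eq hab hcd
      rw [← Equiv.sum_comp (Equiv.mulRight k) (fun g : Equiv.Perm ι => F (g a) (g b))]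
      simp [hk1, hk2]
  have h1 : ∑ c, ∑ d, ∑ g : Equiv.Perm ι, F (g c) (g d) =
      (Fintype.card ι).factorial * ∑ i, ∑ j, F i j := by
    have h2 : ∀ g : Equiv.Perm ι, ∑ c, ∑ d, F (g c) (g d) = ∑ i, ∑ j, F i j := fun g => by
      rw [← Equiv.sum_comp g (fun i => ∑ j, F i j)]
      exact sum_congr rfl fun c _ => Equiv.sum_comp g (F (g c))
    calc ∑ c, ∑ d, ∑ g : Equiv.Perm ι, F (g c) (g d)
        = ∑ g : Equiv.Perm ι, ∑ c, ∑ d, F (g c) (g d) := by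
          rw [sum_comm]
          rw [sum_congr rfl fun c _ => sum_comm]
          rw [sum_comm]
          exact sum_congr rfl fun g _ => sum_comm
      _ = _ := by simp [h2, Fintype.card_perm]
  rw [← h1, sum_congr rfl fun c _ => sum_congr rfl fun d _ => hT c d]
  have h3 : ∀ c : ι, ∑ d, (if c = d then 0 else ∑ g : Equiv.Perm ι, F (g a) (g b)) =
      (Fintype.card ι - 1) * ∑ g : Equiv.Perm ι, F (g a) (g b) := fun c => by
    have : ∀ d, (if c = d then 0 else ∑ g : Equiv.Perm ι, F (g a) (g b)) =
        (∑ g : Equiv.Perm ι, F (g a) (g b)) -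
          if c = d then ∑ g : Equiv.Perm ι, F (g a) (g b) else 0 := fun d => by
      split_ifs <;> ring
    simp only [this, sum_sub_distrib, sum_ite_eq, mem_univ, if_true]
    simp [sub_mul]
  simp [h3, mul_assoc]

/-- The unbiased sample variance of a finite family of reals. -/
noncomputable def unbiasedVar (x : ι → ℝ) : ℝ :=
  ((Fintype.card ι : ℝ) - 1)⁻¹ *
    ∑ i, (x i - (1 / (Fintype.card ι : ℝ)) * ∑ j, x j) ^ 2

theorem sum_sum_sq_sub_div_two {α : Type*} [Fintype α] (x : α → ℝ) (hα : 2 ≤ Fintype.card α) :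
    ∑ i, ∑ j, (x i - x j) ^ 2 / 2 =
      (Fintype.card α : ℝ) * (Fintype.card α - 1) * unbiasedVar x := by
  have hn : (2 : ℝ) ≤ Fintype.card α := by exact_mod_cast hα
  have hn0 : (Fintype.card α : ℝ) ≠ 0 := by linarith
  have hn1 : (Fintype.card α : ℝ) - 1 ≠ 0 := by linarith
  rw [unbiasedVar, mul_assoc, mul_inv_cancel_left₀ hn1]
  simp only [sub_sq, sum_add_distrib, sum_sub_distrib, ← sum_div, ← mul_sum, ← sum_mul, sum_const,
    card_univ, nsmul_eq_mul]
  field_simp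
  ring

/-- The sample variance is the average, over all orderings of the sample, of the mean of
`(x - y) ^ 2 / 2` over disjoint pairs. -/
theorem unbiasedVar_eq_sum_perm {m r : ℕ} (hm : 0 < m) (e : (Fin m × Bool) ⊕ Fin r ≃ ι)
    (hι : 2 ≤ Fintype.card ι) (x : ι → ℝ) :
    m * unbiasedVar x = ∑ g : Equiv.Perm ι, ((Fintype.card ι).factorial : ℝ)⁻¹ *
      ∑ j : Fin m, (x (g (e (Sum.inl (j, false)))) - x (g (e (Sum.inl (j, true))))) ^ 2 / 2 := by
  have hn : (2 : ℝ) ≤ Fintype.card ι := by exact_mod_cast hι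
  have hn0 : (Fintype.card ι : ℝ) ≠ 0 := by linarith
  have hn1 : (Fintype.card ι : ℝ) - 1 ≠ 0 := by linarith
  have hf : ((Fintype.card ι).factorial : ℝ) ≠ 0 := by positivity
  have h : ∀ j : Fin m, ∑ g : Equiv.Perm ι,
      (x (g (e (Sum.inl (j, false)))) - x (g (e (Sum.inl (j, true))))) ^ 2 / 2 =
        (Fintype.card ι).factorial * unbiasedVar x := fun j => by
    have h1 := sum_perm_apply_pair (fun i j => (x i - x j) ^ 2 / 2) (fun i => by simp)
      (a := e (Sum.inl (j, false))) (b := e (Sum.inl (j, true))) (by simp)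
    rw [sum_sum_sq_sub_div_two x hι] at h1
    apply mul_left_cancel₀ (mul_ne_zero hn0 hn1)
    rw [h1]
    ring
  rw [← mul_sum, sum_comm]
  simp only [h, sum_const, card_univ, Fintype.card_fin, nsmul_eq_mul]
  field_simp

theorem iidExp_exp_neg_unbiasedVar_le {m r : ℕ} (hm : 0 < m) (e : (Fin m × Bool) ⊕ Fin r ≃ ι)
    (hι : 2 ≤ Fintype.card ι) {p : T → ℝ} (hp : ∀ τ, 0 ≤ p τ) (hp1 : ∑ τ, p τ = 1)
    (X : T → ℝ) (l : ℝ) :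
    iidExp p (fun ω : ι → T => exp (-l * (m * unbiasedVar fun i => X (ω i)))) ≤
      (∑ τ, ∑ τ', p τ * p τ' * exp (-l * ((X τ - X τ') ^ 2 / 2))) ^ m := by
  have hf : ((Fintype.card ι).factorial : ℝ) ≠ 0 := by positivity
  let G : Equiv.Perm ι → (ι → T) → ℝ := fun g ω => -l * ∑ j : Fin m,
    (X (ω (g (e (Sum.inl (j, false))))) - X (ω (g (e (Sum.inl (j, true)))))) ^ 2 / 2
  have hG : ∀ g, iidExp p (fun ω => exp (G g ω)) =
      (∑ τ, ∑ τ', p τ * p τ' * exp (-l * ((X τ - X τ') ^ 2 / 2))) ^ m := fun g => by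
    refine (iidExp_reindex (e.trans g) p (fun ω => exp (-l * ∑ j : Fin m,
      (X (ω (Sum.inl (j, false))) - X (ω (Sum.inl (j, true)))) ^ 2 / 2))).trans ?_
    refine (iidExp_sumType (κ' := Fin r) hp1 (fun ω => exp (-l * ∑ j : Fin m,
      (X (ω (j, false)) - X (ω (j, true))) ^ 2 / 2))).trans ?_
    simp only [mul_sum, exp_sum]
    exact iidExp_prod_pairs m p (fun τ τ' => exp (-l * ((X τ - X τ') ^ 2 / 2)))
  have hw : ∑ g : Equiv.Perm ι, ((Fintype.card ι).factorial : ℝ)⁻¹ = 1 := by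
    simp [Fintype.card_perm, hf]
  calc iidExp p (fun ω : ι → T => exp (-l * (m * unbiasedVar fun i => X (ω i))))
      ≤ iidExp p (fun ω => ∑ g : Equiv.Perm ι,
          ((Fintype.card ι).factorial : ℝ)⁻¹ * exp (G g ω)) := by
        refine iidExp_mono hp fun ω => ?_
        have := convexOn_exp.map_sum_le (t := univ) (p := fun g => G g ω)
          (fun (g : Equiv.Perm ι) _ => by positivity) hw (fun _ _ => Set.mem_univ _)
        simp only [smul_eq_mul] at this
        refine le_trans (le_of_eq ?_) this
        rw [unbiasedVar_eq_sum_perm hm e hι, mul_sum]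
        congr 1
        exact sum_congr rfl fun g _ => by simp only [G]; ring
    _ = ∑ g : Equiv.Perm ι, ((Fintype.card ι).factorial : ℝ)⁻¹ *
          (∑ τ, ∑ τ', p τ * p τ' * exp (-l * ((X τ - X τ') ^ 2 / 2))) ^ m := by
        rw [iidExp_sum]
        exact sum_congr rfl fun g _ => by rw [iidExp_const_mul, hG]
    _ = _ := by rw [← sum_mul, hw, one_mul]

theorem exp_neg_le_quadratic {z : ℝ} (hz : 0 ≤ z) : exp (-z) ≤ 1 - z + z ^ 2 / 2 := by
  rw [exp_neg]
  have h := quadratic_le_exp_of_nonneg hz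
  refine inv_le_of_inv_le₀ (by nlinarith [sq_nonneg (z - 1)]) (le_trans ?_ h)
  rw [inv_le_iff_one_le_mul₀ (by nlinarith [sq_nonneg (z - 1)])]
  nlinarith [sq_nonneg (z ^ 2)]

theorem sum_sum_exp_neg_le {p X : T → ℝ} (hp : ∀ τ, 0 ≤ p τ) (hp1 : ∑ τ, p τ = 1)
    (hX : ∀ τ, X τ ∈ Set.Icc (0 : ℝ) 1) {μ l : ℝ} (hμ : ∑ τ, p τ * X τ = μ) (hl : 0 ≤ l) :
    ∑ τ, ∑ τ', p τ * p τ' * exp (-l * ((X τ - X τ') ^ 2 / 2)) ≤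
      exp (-l * (∑ τ, p τ * (X τ - μ) ^ 2) + l ^ 2 * (∑ τ, p τ * (X τ - μ) ^ 2) / 4) := by
  set V := ∑ τ, p τ * (X τ - μ) ^ 2 with hV
  have hVar : ∑ τ, ∑ τ', p τ * p τ' * ((X τ - X τ') ^ 2 / 2) = V := by
    have h1 : ∀ τ τ', p τ * p τ' * ((X τ - X τ') ^ 2 / 2) =
        p τ * (X τ - μ) ^ 2 / 2 * p τ' + p τ / 2 * (p τ' * (X τ' - μ) ^ 2)
          - p τ * (X τ - μ) * (p τ' * X τ' - μ * p τ') := fun _ _ => by ring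
    simp only [h1, sum_add_distrib, sum_sub_distrib, ← mul_sum, hp1, hμ, ← hV, ← sum_mul,
      ← sum_div]
    ring
  have hpt : ∀ τ τ', exp (-l * ((X τ - X τ') ^ 2 / 2)) ≤
      1 + (-l + l ^ 2 / 4) * ((X τ - X τ') ^ 2 / 2) := fun τ τ' => by
    rw [neg_mul]
    refine (exp_neg_le_quadratic (by positivity)).trans ?_
    have h1 : (X τ - X τ') ^ 2 ≤ 1 := by
      rw [sq_le_one_iff_abs_le_one, abs_le]
      constructor <;> linarith [(hX τ).1, (hX τ).2, (hX τ').1, (hX τ').2]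
    have h2 := mul_nonneg (mul_nonneg (sq_nonneg l) (sq_nonneg (X τ - X τ'))) (sub_nonneg.2 h1)
    linarith
  calc ∑ τ, ∑ τ', p τ * p τ' * exp (-l * ((X τ - X τ') ^ 2 / 2))
      ≤ ∑ τ, ∑ τ', p τ * p τ' * (1 + (-l + l ^ 2 / 4) * ((X τ - X τ') ^ 2 / 2)) :=
        sum_le_sum fun τ _ => sum_le_sum fun τ' _ =>
          mul_le_mul_of_nonneg_left (hpt τ τ') (mul_nonneg (hp τ) (hp τ'))
    _ = ∑ τ, ∑ τ', (p τ * p τ' + (-l + l ^ 2 / 4) * (p τ * p τ' * ((X τ - X τ') ^ 2 / 2))) :=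
        sum_congr rfl fun _ _ => sum_congr rfl fun _ _ => by ring
    _ = (-l * V + l ^ 2 * V / 4) + 1 := by
        simp only [sum_add_distrib, ← mul_sum, hVar, hp1, mul_one]
        ring
    _ ≤ _ := add_one_le_exp _

/-- Lower deviations of the sample standard deviation of `[0, 1]`-valued samples. -/
theorem sqrt_unbiasedVar_tail (hι : 2 ≤ Fintype.card ι) {p X : T → ℝ} (hp : ∀ τ, 0 ≤ p τ)
    (hp1 : ∑ τ, p τ = 1) (hX : ∀ τ, X τ ∈ Set.Icc (0 : ℝ) 1) {μ L : ℝ}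
    (hμ : ∑ τ, p τ * X τ = μ) (hL : 0 ≤ L) (E : (ι → T) → Prop) [DecidablePred E]
    (hE : ∀ ω, E ω → √(unbiasedVar fun i => X (ω i)) + √(2 * L / (Fintype.card ι - 1)) <
      √(∑ τ, p τ * (X τ - μ) ^ 2)) :
    iidExp p (fun ω : ι → T => if E ω then 1 else 0) ≤ exp (-L) := by
  set V := ∑ τ, p τ * (X τ - μ) ^ 2 with hV
  set n := Fintype.card ι with hn
  set b := √(2 * L / ((n : ℝ) - 1)) with hb
  have hn2 : (2 : ℝ) ≤ n := by exact_mod_cast hι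
  have hb0 : 0 ≤ b := sqrt_nonneg _
  have hb2 : b ^ 2 * (n - 1) = 2 * L := by
    rw [hb, sq_sqrt (div_nonneg (by linarith) (by linarith)), div_mul_cancel₀ _ (by linarith)]
  have hV0 : 0 ≤ V := sum_nonneg fun τ _ => mul_nonneg (hp τ) (sq_nonneg _)
  have hd : √V ^ 2 = V := sq_sqrt hV0
  rcases hV0.eq_or_lt with h0 | hVpos
  · have : ∀ ω, ¬ E ω := fun ω h => by
      have h1 := hE ω h
      rw [← h0, sqrt_zero] at h1
      linarith [sqrt_nonneg (unbiasedVar fun i => X (ω i))]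
    simp [iidExp, this, (exp_pos (-L)).le]
  have hd0 : 0 < √V := sqrt_pos.2 hVpos
  have hm : 0 < n / 2 := by omega
  have hm2 : ((n : ℝ) - 1) ≤ 2 * (n / 2 : ℕ) := by
    have : n ≤ 2 * (n / 2) + 1 := by omega
    have : (n : ℝ) ≤ 2 * (n / 2 : ℕ) + 1 := by exact_mod_cast this
    linarith
  obtain ⟨e⟩ : Nonempty ((Fin (n / 2) × Bool) ⊕ Fin (n % 2) ≃ ι) := by
    rw [← Fintype.card_eq]
    simp only [Fintype.card_sum, Fintype.card_prod, Fintype.card_fin, Fintype.card_bool]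
    omega
  set m := n / 2
  have hm0 : (0 : ℝ) < m := by exact_mod_cast hm
  set l := 2 * b / √V with hl
  have hl0 : 0 ≤ l := by positivity
  have hlV : l * √V = 2 * b := by rw [hl, div_mul_cancel₀ _ hd0.ne']
  refine (iidExp_indicator_le hp E (fun ω => m * (l * V - l * (b * √V)) +
    -l * (m * unbiasedVar fun i => X (ω i))) fun ω h => ?_).trans ?_
  · have h1 := hE ω h
    set W := unbiasedVar fun i => X (ω i)
    have hW0 : 0 ≤ W := mul_nonneg (inv_nonneg.2 (by rw [← hn]; linarith))
      (sum_nonneg fun _ _ => sq_nonneg _)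
    have hW : √W ^ 2 = W := sq_sqrt hW0
    have h2 : W ≤ V - b * √V := by nlinarith [sqrt_nonneg W]
    have := mul_nonneg (mul_nonneg hm0.le hl0) (sub_nonneg.2 h2)
    linarith
  · simp only [exp_add]
    rw [iidExp_const_mul]
    have h1 := iidExp_exp_neg_unbiasedVar_le hm e hι hp hp1 X l
    have h2 := pow_le_pow_left₀ (sum_nonneg fun τ _ => sum_nonneg fun τ' _ =>
      mul_nonneg (mul_nonneg (hp τ) (hp τ')) (exp_pos _).le)
      (sum_sum_exp_neg_le hp hp1 hX hμ hl0) m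
    rw [← exp_nat_mul] at h2
    refine (mul_le_mul_of_nonneg_left (h1.trans h2) (exp_pos _).le).trans ?_
    rw [← exp_add, exp_le_exp, ← hV]
    have h3 : l ^ 2 * V = 4 * b ^ 2 := by
      rw [← hd, ← mul_pow, hlV]; ring
    have h4 : l * (b * √V) = 2 * b ^ 2 := by
      rw [mul_left_comm, hlV]; ring
    rw [h3, h4]
    nlinarith [mul_le_mul_of_nonneg_left hm2 (sq_nonneg b)]

/-- The empirical Bernstein inequality of Maurer and Pontil (one-sided). -/
theorem empirical_bernstein_tail (hι : 2 ≤ Fintype.card ι) {p X : T → ℝ} (hp : ∀ τ, 0 ≤ p τ)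
    (hp1 : ∑ τ, p τ = 1) (hX : ∀ τ, X τ ∈ Set.Icc (0 : ℝ) 1) {μ L : ℝ}
    (hμ : ∑ τ, p τ * X τ = μ) (hL : 0 ≤ L) (E : (ι → T) → Prop) [DecidablePred E]
    (hE : ∀ ω, E ω → √(2 * L / Fintype.card ι) * √(unbiasedVar fun i => X (ω i)) +
      7 * L / (3 * (Fintype.card ι - 1)) < μ - 1 / (Fintype.card ι : ℝ) * ∑ i, X (ω i)) :
    iidExp p (fun ω : ι → T => if E ω then 1 else 0) ≤ 2 * exp (-L) := by
  classical
  set n := Fintype.card ι with hn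
  set V := ∑ τ, p τ * (X τ - μ) ^ 2 with hV
  set a := √(2 * L / (n : ℝ)) with ha
  set b := √(2 * L / ((n : ℝ) - 1)) with hb
  have hn2 : (2 : ℝ) ≤ n := by exact_mod_cast hι
  have hn0 : (0 : ℝ) < n := by linarith
  have hn1 : (0 : ℝ) < n - 1 := by linarith
  have ha0 : 0 ≤ a := sqrt_nonneg _
  have ha2 : a ^ 2 = 2 * L / n := sq_sqrt (by positivity)
  have hb2 : b ^ 2 = 2 * L / (n - 1) := sq_sqrt (by positivity)
  have hab : a ≤ b := sqrt_le_sqrt (div_le_div_of_nonneg_left (by positivity) hn1 (by linarith))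
  have hV0 : 0 ≤ V := sum_nonneg fun τ _ => mul_nonneg (hp τ) (sq_nonneg _)
  have hμ0 : 0 ≤ μ := hμ ▸ sum_nonneg fun τ _ => mul_nonneg (hp τ) (hX τ).1
  have hμ1 : μ ≤ 1 := by
    rw [← hμ, ← hp1]
    exact sum_le_sum fun τ _ => mul_le_of_le_one_right (hp τ) (hX τ).2
  let E₁ : (ι → T) → Prop := fun ω => √(2 * (n * V) * L) + L / 3 ≤ ∑ i, (μ - X (ω i))
  let E₂ : (ι → T) → Prop := fun ω => √(unbiasedVar fun i => X (ω i)) + b < √V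
  have h₁ : iidExp p (fun ω => if E₁ ω then 1 else 0) ≤ exp (-L) := by
    refine bernstein_tail (Y := fun τ => μ - X τ) hp hp1 (fun τ => ?_) ?_ hL E₁ fun ω h => ?_
    · rw [abs_le]
      constructor <;> linarith [(hX τ).1, (hX τ).2]
    · simp [mul_sub, hμ, ← sum_mul, hp1]
    · have hV' : ∑ τ, p τ * (μ - X τ) ^ 2 = V :=
        sum_congr rfl fun τ _ => by rw [sub_sq_comm]
      rw [hV']
      exact h
  have h₂ : iidExp p (fun ω => if E₂ ω then 1 else 0) ≤ exp (-L) :=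
    sqrt_unbiasedVar_tail hι hp hp1 hX hμ hL E₂ fun ω h => h
  have hor : ∀ ω, E ω → E₁ ω ∨ E₂ ω := fun ω h => by
    by_contra! hno
    obtain ⟨hno₁, hno₂⟩ := hno
    simp only [E₁, E₂, not_le, not_lt] at hno₁ hno₂
    have h1 := hE ω h
    have hs : ∑ i, (μ - X (ω i)) = n * (μ - 1 / (n : ℝ) * ∑ i, X (ω i)) := by
      rw [sum_sub_distrib, sum_const, card_univ, nsmul_eq_mul, ← hn]
      field_simp
    have hr : √(2 * (n * V) * L) = n * (a * √V) := by
      rw [sqrt_eq_iff_mul_self_eq (by positivity) (by positivity)]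
      calc 2 * (n * V) * L = n ^ 2 * (2 * L / n * V) := by field_simp
        _ = n ^ 2 * (a ^ 2 * √V ^ 2) := by rw [ha2, sq_sqrt hV0]
        _ = n * (a * √V) * (n * (a * √V)) := by ring
    rw [hs, hr] at hno₁
    have h2 := mul_le_mul_of_nonneg_left hno₂ ha0
    have h3 : a * b ≤ 2 * L / (n - 1) := by
      rw [← hb2, sq]
      exact mul_le_mul_of_nonneg_right hab (sqrt_nonneg _)
    have h4 : L / 3 ≤ n * (L / (3 * (n - 1))) := by
      rw [← mul_div_assoc, div_le_div_iff₀ (by norm_num) (by positivity)]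
      nlinarith
    have h5 : 7 * L / (3 * (n - 1)) = 2 * L / (n - 1) + L / (3 * (n - 1)) := by
      field_simp
      ring
    have h6 : a * √V + L / (3 * (n - 1)) < μ - 1 / (n : ℝ) * ∑ i, X (ω i) := by
      linarith
    have h7 := mul_lt_mul_of_pos_left h6 hn0
    linarith
  calc iidExp p (fun ω : ι → T => if E ω then 1 else 0)
      ≤ iidExp p (fun ω => (if E₁ ω then 1 else 0) + if E₂ ω then 1 else 0) := by
        refine iidExp_mono hp fun ω => ?_
        by_cases h : E ω
        · rcases hor ω h with h' | h' <;> simp only [h, h', if_true] <;> split_ifs <;> norm_num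
        · rw [if_neg h]
          positivity
    _ ≤ 2 * exp (-L) := by
        rw [iidExp_add]
        linarith

end IidConcentration

section EStop

variable {S A : Type*} [Fintype S] [Fintype A]

/-- State-to-state transition probabilities at time `t` under a policy. -/
noncomputable def stepKernel (P : S → A → S → ℝ) (pol : ℕ → S → A → ℝ) (t : ℕ) (s s' : S) : ℝ :=
  ∑ a, pol t s a * P s a s'

theorem stateDist_succ (P : S → A → S → ℝ) (pol : ℕ → S → A → ℝ) (ρ0 : S → ℝ) (t : ℕ) (s : S) :
    stateDist P pol ρ0 (t + 1) s = ∑ s', stateDist P pol ρ0 t s' * stepKernel P pol t s' s := by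
  simp only [stateDist, stepKernel, mul_sum, mul_assoc]

theorem stepKernel_nonneg (M : MDP S A) (π : Policy S A) (t : ℕ) (s s' : S) :
    0 ≤ stepKernel M.P π.p t s s' :=
  sum_nonneg fun a _ => mul_nonneg (π.nonneg t s a) (M.P_nonneg s a s')

theorem sum_stepKernel (M : MDP S A) (π : Policy S A) (t : ℕ) (s : S) :
    ∑ s', stepKernel M.P π.p t s s' = 1 := by
  unfold stepKernel
  rw [sum_comm]
  simp [← mul_sum, M.P_sum, π.sum_one]

/-- Probability of a path under an initial distribution and time-dependent kernels. -/
noncomputable def pathProb (ρ0 : S → ℝ) (Q : ℕ → S → S → ℝ) (k : ℕ) (τ : Fin (k + 1) → S) : ℝ :=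
  ρ0 (τ 0) * ∏ t : Fin k, Q t (τ t.castSucc) (τ t.succ)

omit [Fintype S] in
theorem pathProb_snoc (ρ0 : S → ℝ) (Q : ℕ → S → S → ℝ) (k : ℕ) (τ : Fin (k + 1) → S) (x : S) :
    pathProb ρ0 Q (k + 1) (Fin.snoc (α := fun _ => S) τ x) =
      pathProb ρ0 Q k τ * Q k (τ (Fin.last k)) x := by
  unfold pathProb
  have h0 : (Fin.snoc (α := fun _ => S) τ x : Fin (k + 2) → S) 0 = τ 0 :=
    Fin.snoc_castSucc (α := fun _ => S) x τ 0
  rw [Fin.prod_univ_castSucc, h0, mul_assoc]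
  simp only [Fin.snoc_castSucc, Fin.succ_last, Fin.snoc_last, Fin.val_last, Fin.val_castSucc,
    Fin.succ_castSucc]

theorem sum_pathProb_mul (M : MDP S A) (π : Policy S A) (k : ℕ) (t : Fin (k + 1)) (f : S → ℝ) :
    ∑ τ, pathProb M.ρ0 (stepKernel M.P π.p) k τ * f (τ t) =
      ∑ s, stateDist M.P π.p M.ρ0 t s * f s := by
  induction k generalizing f with
  | zero =>
    obtain rfl : t = 0 := Fin.fin_one_eq_zero t
    refine Fintype.sum_equiv (Equiv.funUnique (Fin 1) S) _ _ fun τ => ?_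
    simp [pathProb, stateDist]
  | succ k ih =>
    rw [← (Fin.snocEquiv (fun _ => S)).sum_comp, Fintype.sum_prod_type, sum_comm]
    simp only [Fin.snocEquiv, Equiv.coe_fn_mk, pathProb_snoc]
    induction t using Fin.lastCases with
    | last =>
      simp only [Fin.snoc_last, mul_assoc, ← mul_sum]
      rw [ih (Fin.last k) (fun s' => ∑ s, stepKernel M.P π.p k s' s * f s)]
      simp only [Fin.val_last, stateDist_succ, mul_sum, sum_mul, ← mul_assoc]
      exact sum_comm
    | cast t =>
      simp only [Fin.snoc_castSucc, Fin.val_castSucc, ← ih, mul_right_comm _ _ (f _), ← mul_sum,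
        sum_stepKernel, mul_one]

theorem sum_trajProb_mul (M : MDP S A) (π : Policy S A) (t : Fin M.H) (f : S → ℝ) :
    ∑ τ, trajProb M π τ * f (τ t) = ∑ s, stateDist M.P π.p M.ρ0 t s * f s := by
  obtain ⟨P, hP, hP1, R, hR, hR1, H, hH, ρ0, hρ, hρ1⟩ := M
  cases H with
  | zero => exact absurd hH (lt_irrefl 0)
  | succ k =>
    exact sum_pathProb_mul ⟨P, hP, hP1, R, hR, hR1, k + 1, hH, ρ0, hρ, hρ1⟩ π k t f

theorem trajProb_nonneg (M : MDP S A) (π : Policy S A) (τ : Fin M.H → S) : 0 ≤ trajProb M π τ :=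
  mul_nonneg (M.ρ0_nonneg _) (prod_nonneg fun _ _ => sum_nonneg fun _ _ =>
    mul_nonneg (π.nonneg _ _ _) (M.P_nonneg _ _ _))

theorem stateDist_nonneg (M : MDP S A) (π : Policy S A) (t : ℕ) (s : S) :
    0 ≤ stateDist M.P π.p M.ρ0 t s := by
  induction t generalizing s with
  | zero => exact M.ρ0_nonneg s
  | succ t ih =>
    rw [stateDist_succ]
    exact sum_nonneg fun s' _ => mul_nonneg (ih s') (stepKernel_nonneg M π t s' s)

theorem sum_stateDist (M : MDP S A) (π : Policy S A) (t : ℕ) :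
    ∑ s, stateDist M.P π.p M.ρ0 t s = 1 := by
  induction t with
  | zero => exact M.ρ0_sum
  | succ t ih =>
    simp only [stateDist_succ]
    rw [sum_comm]
    simp only [← mul_sum, sum_stepKernel, mul_one, ih]

theorem sum_trajProb (M : MDP S A) (π : Policy S A) : ∑ τ, trajProb M π τ = 1 := by
  simpa [sum_stateDist] using sum_trajProb_mul M π ⟨0, M.H_pos⟩ fun _ => 1

variable [DecidableEq S]

omit [Fintype S] in
theorem occ_mem_Icc {H : ℕ} (τ : Fin H → S) (s : S) : occ τ s ∈ Set.Icc (0 : ℝ) 1 := by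
  refine ⟨div_nonneg (Nat.cast_nonneg _) (Nat.cast_nonneg _),
    div_le_one_of_le₀ ?_ (Nat.cast_nonneg _)⟩
  exact_mod_cast (card_filter_le _ _).trans_eq (by simp)

theorem sum_trajProb_mul_occ (M : MDP S A) (π : Policy S A) (s : S) :
    ∑ τ, trajProb M π τ * occ τ s = avgDist M π s := by
  have h : ∀ τ : Fin M.H → S, trajProb M π τ * occ τ s =
      (M.H : ℝ)⁻¹ * ∑ t, trajProb M π τ * if τ t = s then 1 else 0 := fun τ => by
    rw [occ, ← mul_sum, sum_boole]
    ring
  rw [sum_congr rfl fun τ _ => h τ, ← mul_sum, sum_comm, avgDist, ← Fin.sum_univ_eq_sum_range]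
  congr 1
  refine sum_congr rfl fun t _ => ?_
  rw [sum_trajProb_mul M π t fun x => if x = s then 1 else 0]
  simp

theorem sum_estate (Shat : Finset S) (F : EState S Shat → ℝ) (hF : F none = 0) :
    ∑ x, F x = ∑ s, if h : s ∈ Shat then F (some ⟨s, h⟩) else 0 := by
  rw [Fintype.sum_option, hF, zero_add,
    ← sum_subset (subset_univ Shat) (fun s _ hs => dif_neg hs), ← sum_attach Shat, univ_eq_attach]
  exact sum_congr rfl fun s _ => by simp

/-- Mass that the e-stop MDP puts on the state `s` of the original MDP at time `t`. -/
noncomputable def estopMass (M : MDP S A) (Shat : Finset S) (π : Policy S A) (t : ℕ) (s : S) : ℝ :=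
  if h : s ∈ Shat then
    stateDist (estopP M.P Shat) (estopPol π.p Shat) (estopρ0 M.ρ0 Shat) t (some ⟨s, h⟩)
  else 0

theorem estopMass_zero (M : MDP S A) (Shat : Finset S) (π : Policy S A) (s : S) :
    estopMass M Shat π 0 s = if s ∈ Shat then M.ρ0 s else 0 := by
  by_cases h : s ∈ Shat <;> simp [estopMass, h, stateDist, estopρ0]

theorem estopMass_succ (M : MDP S A) (Shat : Finset S) (π : Policy S A) (t : ℕ) (s : S) :
    estopMass M Shat π (t + 1) s =
      if s ∈ Shat then ∑ s', estopMass M Shat π t s' * stepKernel M.P π.p t s' s else 0 := by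
  by_cases h : s ∈ Shat
  · simp only [estopMass, h, dif_pos, if_true, stateDist_succ]
    rw [sum_estate]
    · refine sum_congr rfl fun s' _ => ?_
      split_ifs
      · rfl
      · simp
    · simp [stepKernel, estopP]
  · simp [estopMass, h]

theorem estopMass_nonneg (M : MDP S A) (Shat : Finset S) (π : Policy S A) (t : ℕ) (s : S) :
    0 ≤ estopMass M Shat π t s := by
  induction t generalizing s with
  | zero =>
    rw [estopMass_zero]
    split_ifs
    exacts [M.ρ0_nonneg s, le_rfl]
  | succ t ih =>
    rw [estopMass_succ]
    split_ifs
    exacts [sum_nonneg fun s' _ => mul_nonneg (ih s') (stepKernel_nonneg M π t s' s), le_rfl]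

theorem estopMass_le (M : MDP S A) (Shat : Finset S) (π : Policy S A) (t : ℕ) (s : S) :
    estopMass M Shat π t s ≤ stateDist M.P π.p M.ρ0 t s := by
  induction t generalizing s with
  | zero =>
    rw [estopMass_zero]
    split_ifs
    exacts [le_rfl, M.ρ0_nonneg s]
  | succ t ih =>
    rw [estopMass_succ]
    split_ifs
    · rw [stateDist_succ]
      exact sum_le_sum fun s' _ => mul_le_mul_of_nonneg_right (ih s') (stepKernel_nonneg M π t s' s)
    · exact stateDist_nonneg M π (t + 1) s

theorem one_sub_sum_estopMass_le (M : MDP S A) (Shat : Finset S) (π : Policy S A) (t : ℕ) :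
    1 - ∑ s, estopMass M Shat π t s ≤
      ∑ u ∈ range (t + 1), ∑ s ∈ Shatᶜ, stateDist M.P π.p M.ρ0 u s := by
  induction t with
  | zero =>
    simp only [estopMass_zero, zero_add, range_one, sum_singleton, stateDist]
    rw [← sum_filter, filter_mem_eq_inter, univ_inter, ← M.ρ0_sum, ← sum_compl_add_sum Shat]
    linarith
  | succ t ih =>
    rw [sum_range_succ]
    have h1 : ∑ s, ∑ s', estopMass M Shat π t s' * stepKernel M.P π.p t s' s =
        ∑ s, estopMass M Shat π t s := by
      rw [sum_comm]
      simp only [← mul_sum, sum_stepKernel, mul_one]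
    have h2 : ∑ s ∈ Shatᶜ, ∑ s', estopMass M Shat π t s' * stepKernel M.P π.p t s' s ≤
        ∑ s ∈ Shatᶜ, stateDist M.P π.p M.ρ0 (t + 1) s := by
      simp only [stateDist_succ]
      exact sum_le_sum fun s _ => sum_le_sum fun s' _ =>
        mul_le_mul_of_nonneg_right (estopMass_le M Shat π t s') (stepKernel_nonneg M π t s' s)
    rw [← sum_compl_add_sum Shat] at h1
    have h3 : ∑ s, estopMass M Shat π (t + 1) s =
        ∑ s ∈ Shat, ∑ s', estopMass M Shat π t s' * stepKernel M.P π.p t s' s := by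
      simp only [estopMass_succ]
      rw [← sum_filter, filter_mem_eq_inter, univ_inter]
    linarith

theorem estopJ_eq (M : MDP S A) (Shat : Finset S) (π : Policy S A) :
    estopJ M Shat π = ∑ t ∈ range (M.H - 1), ∑ s, ∑ a, ∑ s',
      estopMass M Shat π t s * π.p t s a * (if s' ∈ Shat then M.P s a s' else 0) * M.R s a s' := by
  unfold estopJ valueJ
  refine sum_congr rfl fun t _ => ?_
  rw [sum_estate _ _ (by simp [estopR])]
  refine sum_congr rfl fun s _ => ?_
  by_cases h : s ∈ Shat
  · simp only [h, dif_pos, estopMass]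
    refine sum_congr rfl fun a _ => ?_
    rw [sum_estate _ _ (by simp [estopR])]
    refine sum_congr rfl fun s' _ => ?_
    by_cases h' : s' ∈ Shat <;> simp [h', estopPol, estopP, estopR]
  · simp [h, estopMass]

theorem estop_term_le (M : MDP S A) (Shat : Finset S) (π : Policy S A) (t : ℕ) (s s' : S) (a : A) :
    estopMass M Shat π t s * π.p t s a * (if s' ∈ Shat then M.P s a s' else 0) ≤
      stateDist M.P π.p M.ρ0 t s * π.p t s a * M.P s a s' := by
  have h1 : (if s' ∈ Shat then M.P s a s' else 0) ≤ M.P s a s' := by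
    split_ifs
    exacts [le_rfl, M.P_nonneg s a s']
  have h2 := mul_le_mul_of_nonneg_right (estopMass_le M Shat π t s) (π.nonneg t s a)
  refine (mul_le_mul_of_nonneg_left h1
    (mul_nonneg (estopMass_nonneg M Shat π t s) (π.nonneg t s a))).trans ?_
  exact mul_le_mul_of_nonneg_right h2 (M.P_nonneg s a s')

/-- Early stopping can only lose reward. -/
theorem estopJ_le_J (M : MDP S A) (Shat : Finset S) (π : Policy S A) :
    estopJ M Shat π ≤ M.J π := by
  rw [estopJ_eq, MDP.J, valueJ]
  exact sum_le_sum fun t _ => sum_le_sum fun s _ => sum_le_sum fun a _ => sum_le_sum fun s' _ =>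
    mul_le_mul_of_nonneg_right (estop_term_le M Shat π t s s' a) (M.R_nonneg s a s')

/-- The reward lost by early stopping is controlled by the occupancy of the removed states. -/
theorem J_sub_estopJ_le (M : MDP S A) (Shat : Finset S) (π : Policy S A) :
    M.J π - estopJ M Shat π ≤ (∑ s ∈ Shatᶜ, avgDist M π s) * (M.H : ℝ) ^ 2 := by
  set U : ℕ → ℝ := fun u => ∑ s ∈ Shatᶜ, stateDist M.P π.p M.ρ0 u s with hU
  have hU0 : ∀ u, 0 ≤ U u := fun u => sum_nonneg fun s _ => stateDist_nonneg M π u s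
  have hH : (0 : ℝ) < M.H := by exact_mod_cast M.H_pos
  have hstep : ∀ t, ∑ s, ∑ a, ∑ s', (stateDist M.P π.p M.ρ0 t s * π.p t s a * M.P s a s' -
      estopMass M Shat π t s * π.p t s a * (if s' ∈ Shat then M.P s a s' else 0)) =
        1 - ∑ s, estopMass M Shat π (t + 1) s := fun t => by
    simp only [sum_sub_distrib]
    congr 1
    · simp only [← mul_sum, M.P_sum, mul_one, π.sum_one, sum_stateDist]
    · simp only [estopMass_succ, stepKernel]
      rw [sum_congr rfl fun s _ => sum_comm, sum_comm]
      refine sum_congr rfl fun s' _ => ?_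
      split_ifs <;> simp [mul_sum, mul_assoc]
  have hterm : ∀ t ∈ range (M.H - 1),
      ∑ s, ∑ a, ∑ s', (stateDist M.P π.p M.ρ0 t s * π.p t s a * M.P s a s' * M.R s a s' -
        estopMass M Shat π t s * π.p t s a * (if s' ∈ Shat then M.P s a s' else 0) *
          M.R s a s') ≤ ∑ u ∈ range M.H, U u := fun t ht => by
    have ht' : t + 2 ≤ M.H := by have := mem_range.1 ht; omega
    calc _ ≤ ∑ s, ∑ a, ∑ s', (stateDist M.P π.p M.ρ0 t s * π.p t s a * M.P s a s' -
          estopMass M Shat π t s * π.p t s a * (if s' ∈ Shat then M.P s a s' else 0)) :=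
          sum_le_sum fun s _ => sum_le_sum fun a _ => sum_le_sum fun s' _ => by
            rw [← sub_mul]
            exact mul_le_of_le_one_right (sub_nonneg.2 (estop_term_le M Shat π t s s' a))
              (M.R_le_one s a s')
      _ ≤ ∑ u ∈ range (t + 2), U u := by
          rw [hstep]
          exact one_sub_sum_estopMass_le M Shat π (t + 1)
      _ ≤ _ := sum_le_sum_of_subset_of_nonneg (range_mono ht') fun u _ _ => hU0 u
  have havg : ∑ u ∈ range M.H, U u = M.H * ∑ s ∈ Shatᶜ, avgDist M π s := by
    simp only [avgDist, ← mul_sum, hU]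
    rw [mul_inv_cancel_left₀ hH.ne', sum_comm]
  have hsum := sum_le_card_nsmul _ _ _ hterm
  have h0 : 0 ≤ ∑ s ∈ Shatᶜ, avgDist M π s := by
    have := sum_nonneg fun u (_ : u ∈ range M.H) => hU0 u
    rw [havg] at this
    exact nonneg_of_mul_nonneg_right this hH
  rw [estopJ_eq, MDP.J, valueJ]
  simp only [← sum_sub_distrib]
  refine hsum.trans ?_
  rw [card_range, nsmul_eq_mul, havg]
  have h1 : ((M.H - 1 : ℕ) : ℝ) ≤ M.H := by exact_mod_cast Nat.sub_le _ _
  calc ((M.H - 1 : ℕ) : ℝ) * (M.H * ∑ s ∈ Shatᶜ, avgDist M π s)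
      ≤ M.H * (M.H * ∑ s ∈ Shatᶜ, avgDist M π s) := by gcongr
    _ = _ := by ring

theorem J_sub_J_le_of_optimal (M : MDP S A) (Shat : Finset S) (π π' : Policy S A)
    (h : estopJ M Shat π ≤ estopJ M Shat π') :
    M.J π - M.J π' ≤ (∑ s ∈ Shatᶜ, avgDist M π s) * (M.H : ℝ) ^ 2 := by
  linarith [J_sub_estopJ_le M Shat π, estopJ_le_J M Shat π']

end EStop

theorem sampleVar_eq_unbiasedVar {S : Type*} [DecidableEq S] {H n : ℕ} (ω : Fin n → Fin H → S)
    (s : S) : sampleVar ω s = unbiasedVar fun i => occ (ω i) s := by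
  simp [sampleVar, unbiasedVar, empAvg]

/-- empirical-Bernstein version of the learned e-stop bound. If the
(sample-dependent) set `Ŝ` removes states of total empirical average-distribution mass at
most `ξ`, then with probability at least `1 − δ` over the `n ≥ 2` i.i.d. expert
trajectories,
`J_M(π_e) − J_M(π̂*) ≤ (ξ + √(2 log(2|S|/δ)/n) · ∑_s √(V_n(s)) + 7|S| log(2|S|/δ)/(3(n−1))) · H²`. -/
theorem learned_estop_bernstein
    {S A : Type*} [Fintype S] [DecidableEq S] [Fintype A]
    (M : MDP S A) (πe : Policy S A)
    (δ ξ : ℝ) (hδ : 0 < δ) (hδ1 : δ < 1) (hξ : 0 ≤ ξ)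
    (n : ℕ) (hn : 2 ≤ n)
    (Shat : (Fin n → Fin M.H → S) → Finset S)
    (hShat : ∀ ω, ∑ s ∈ (Shat ω)ᶜ, empAvg ω s ≤ ξ)
    (πhatstar : (Fin n → Fin M.H → S) → Policy S A)
    (hπhatstar : ∀ ω (π : Policy S A),
      estopJ M (Shat ω) π ≤ estopJ M (Shat ω) (πhatstar ω)) :
    1 - δ ≤
      ∑ ω : Fin n → Fin M.H → S,
        (∏ i : Fin n, trajProb M πe (ω i)) *
          (if M.J πe - M.J (πhatstar ω) ≤
              (ξ + Real.sqrt (2 * Real.log (2 * Fintype.card S / δ) / n) *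
                  ∑ s : S, Real.sqrt (sampleVar ω s) +
                7 * (Fintype.card S : ℝ) * Real.log (2 * Fintype.card S / δ) /
                  (3 * ((n : ℝ) - 1))) * (M.H : ℝ) ^ 2
            then 1 else 0) := by
  have hn2 : (2 : ℝ) ≤ n := by exact_mod_cast hn
  have hS : (1 : ℝ) ≤ Fintype.card S := by
    have : Nonempty S := by
      by_contra hempty
      rw [not_nonempty_iff] at hempty
      simpa using M.ρ0_sum
    exact_mod_cast Fintype.card_pos
  set L := Real.log (2 * Fintype.card S / δ) with hLdef
  have hL : 0 ≤ L := Real.log_nonneg (by rw [le_div_iff₀ hδ]; linarith)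
  have hexp : Real.exp (-L) = δ / (2 * Fintype.card S) := by
    rw [Real.exp_neg, hLdef, Real.exp_log (by positivity), inv_div]
  let dev : (Fin n → Fin M.H → S) → S → ℝ := fun ω s =>
    √(2 * L / n) * √(sampleVar ω s) + 7 * L / (3 * ((n : ℝ) - 1))
  have htail : ∀ s, iidExp (trajProb M πe)
      (fun ω : Fin n → Fin M.H → S => if dev ω s < avgDist M πe s - empAvg ω s then 1 else 0) ≤
        2 * Real.exp (-L) := fun s => by
    refine empirical_bernstein_tail (X := fun τ => occ τ s) (by simpa using hn)
      (trajProb_nonneg M πe) (sum_trajProb M πe) (fun τ => occ_mem_Icc τ s)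
      (sum_trajProb_mul_occ M πe s) hL _ fun ω h => ?_
    rw [Fintype.card_fin, ← sampleVar_eq_unbiasedVar]
    exact h
  have hgood : ∀ ω : Fin n → Fin M.H → S, (∀ s, avgDist M πe s - empAvg ω s ≤ dev ω s) →
      M.J πe - M.J (πhatstar ω) ≤ (ξ + √(2 * L / n) * ∑ s, √(sampleVar ω s) +
        7 * (Fintype.card S : ℝ) * L / (3 * ((n : ℝ) - 1))) * (M.H : ℝ) ^ 2 := fun ω h => by
    refine (J_sub_J_le_of_optimal M (Shat ω) πe _ (hπhatstar ω πe)).trans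
      (mul_le_mul_of_nonneg_right ?_ (sq_nonneg _))
    have hdev0 : ∀ s, 0 ≤ dev ω s := fun s => by
      have : (0 : ℝ) < n - 1 := by linarith
      positivity
    calc ∑ s ∈ (Shat ω)ᶜ, avgDist M πe s
        ≤ ∑ s ∈ (Shat ω)ᶜ, (empAvg ω s + dev ω s) :=
          sum_le_sum fun s _ => by linarith [h s]
      _ ≤ ξ + ∑ s, dev ω s := by
          rw [sum_add_distrib]
          exact add_le_add (hShat ω)
            (sum_le_sum_of_subset_of_nonneg (subset_univ _) fun s _ _ => hdev0 s)
      _ = _ := by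
          simp only [dev, sum_add_distrib, ← mul_sum, sum_const, card_univ, nsmul_eq_mul]
          ring
  have hδsum : ∑ _s : S, 2 * Real.exp (-L) = δ := by
    rw [sum_const, card_univ, nsmul_eq_mul, hexp]
    field_simp
  have hunion : ∀ G : (Fin n → Fin M.H → S) → ℝ,
      (∀ ω, 1 ≤ G ω + ∑ s, if dev ω s < avgDist M πe s - empAvg ω s then 1 else 0) →
        1 - δ ≤ iidExp (trajProb M πe) G := fun G hG => by
    have h1 := iidExp_mono (trajProb_nonneg M πe) hG
    rw [iidExp_one (sum_trajProb M πe), iidExp_add, iidExp_sum] at h1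
    linarith [(sum_le_sum fun s (_ : s ∈ univ) => htail s).trans_eq hδsum]
  refine hunion _ fun ω => ?_
  by_cases h : ∀ s, avgDist M πe s - empAvg ω s ≤ dev ω s
  · rw [if_pos (hgood ω h)]
    exact le_add_of_nonneg_right (sum_nonneg fun s _ => by split_ifs <;> norm_num)
  · push Not at h
    obtain ⟨s, hs⟩ := h
    have h1 : (1 : ℝ) ≤ ∑ s, if dev ω s < avgDist M πe s - empAvg ω s then 1 else 0 :=
      le_trans (by rw [if_pos hs]) (single_le_sum
        (f := fun s => if dev ω s < avgDist M πe s - empAvg ω s then (1 : ℝ) else 0)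
        (fun s _ => by split_ifs <;> norm_num) (mem_univ s))
    refine h1.trans (le_add_of_nonneg_left ?_)
    split_ifs <;> norm_num
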